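/- Fix n ≥ 1 and 1 ≤ p ≤ ∞, and let D_p(t) = (1/n)[E_{h∼N(0,I_n)} dist(h, {x : ‖x‖_{p*} ≤ t})]² for t ≥ 0. Then D_p is a strictly decreasing convex function of t on [0,∞), and lim_{t→∞} D_p(t) = 0. -/

import Mathlib

open MeasureTheory ProbabilityTheory Filter
open scoped ENNReal NNReal

/-- The standard Gaussian measure `N(0, I_n)` on `ℝ^n`. -/
noncomputable def stdGaussian (n : ℕ) : Measure (Fin n → ℝ) :=
  Measure.pi fun _ => gaussianReal 0 1

/-- The Euclidean (`ℓ²`) norm on `ℝ^n`. -/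
noncomputable def l2norm {n : ℕ} (x : Fin n → ℝ) : ℝ := Real.sqrt (∑ i, x i ^ 2)

/-- The `ℓ^q` norm on `ℝ^n` for an extended exponent `q ∈ [1, ∞]`. -/
noncomputable def lqNorm {n : ℕ} (q : ℝ≥0∞) (x : Fin n → ℝ) : ℝ :=
  if q = ⊤ then ⨆ i, |x i| else (∑ i, |x i| ^ q.toReal) ^ (1 / q.toReal)

/-- Euclidean distance from `h ∈ ℝ^n` to a set `C ⊆ ℝ^n`. -/
noncomputable def distL2 {n : ℕ} (C : Set (Fin n → ℝ)) (h : Fin n → ℝ) : ℝ :=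
  sInf ((fun w => l2norm (h - w)) '' C)

/-- `D_p(t; n) = (1/n) (E_{h ∼ N(0,I_n)} dist(h, {x : ‖x‖_{p*} ≤ t}))²`, expressed in terms
of the Hölder conjugate exponent `q = p*`. -/
noncomputable def Dp (q : ℝ≥0∞) (n : ℕ) (t : ℝ) : ℝ :=
  (1 / n) * (∫ h, distL2 {x | lqNorm q x ≤ t} h ∂stdGaussian n) ^ 2

lemma lqNorm_eq_norm_toLp {n : ℕ} {q : ℝ≥0∞} (hq : 1 ≤ q) (x : Fin n → ℝ) :
    lqNorm q x = ‖WithLp.toLp q x‖ := by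
  unfold lqNorm
  split_ifs with h
  · subst h
    simp [PiLp.norm_eq_ciSup]
  · have hpos : 0 < q.toReal := ENNReal.toReal_pos (by positivity) h
    simp [PiLp.norm_eq_sum hpos]

lemma l2norm_eq_norm_toLp {n : ℕ} (x : Fin n → ℝ) : l2norm x = ‖WithLp.toLp 2 x‖ := by
  simp [l2norm, EuclideanSpace.norm_eq]

lemma distL2_eq_infDist {n : ℕ} (C : Set (Fin n → ℝ)) (h : Fin n → ℝ) :
    distL2 C h = Metric.infDist (WithLp.toLp 2 h) (WithLp.toLp 2 '' C) := by
  rw [Metric.infDist_eq_iInf, distL2, iInf, ← Set.image_eq_range, Set.image_image]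
  simp_rw [l2norm_eq_norm_toLp, dist_eq_norm, WithLp.toLp_sub]

lemma distL2_nonneg {n : ℕ} (C : Set (Fin n → ℝ)) (h : Fin n → ℝ) : 0 ≤ distL2 C h := by
  rw [distL2_eq_infDist]
  exact Metric.infDist_nonneg

lemma distL2_le_of_mem {n : ℕ} {C : Set (Fin n → ℝ)} {w : Fin n → ℝ} (hw : w ∈ C)
    (h : Fin n → ℝ) : distL2 C h ≤ l2norm (h - w) := by
  rw [distL2_eq_infDist, l2norm_eq_norm_toLp, WithLp.toLp_sub, ← dist_eq_norm]
  exact Metric.infDist_le_dist_of_mem (Set.mem_image_of_mem _ hw)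

lemma continuous_distL2 {n : ℕ} (C : Set (Fin n → ℝ)) : Continuous (distL2 C) := by
  simp_rw [funext (distL2_eq_infDist C)]
  exact (Metric.continuous_infDist_pt _).comp (PiLp.continuous_toLp 2 _)

lemma exists_mem_l2norm_sub_lt {n : ℕ} {C : Set (Fin n → ℝ)} (hC : C.Nonempty) (h : Fin n → ℝ)
    {r : ℝ} (hr : distL2 C h < r) : ∃ w ∈ C, l2norm (h - w) < r := by
  obtain ⟨_, ⟨w, hw, rfl⟩, hlt⟩ := exists_lt_of_csInf_lt (hC.image _) hr
  exact ⟨w, hw, hlt⟩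

lemma zero_mem_lqBall {n : ℕ} {q : ℝ≥0∞} (hq : 1 ≤ q) {t : ℝ} (ht : 0 ≤ t) :
    (0 : Fin n → ℝ) ∈ {x | lqNorm q x ≤ t} := by
  have : Fact (1 ≤ q) := ⟨hq⟩
  simpa [lqNorm_eq_norm_toLp hq] using ht

lemma convexOn_distL2_lqBall {n : ℕ} {q : ℝ≥0∞} (hq : 1 ≤ q) (h : Fin n → ℝ) :
    ConvexOn ℝ (Set.Ici 0) fun t => distL2 {x | lqNorm q x ≤ t} h := by
  have : Fact (1 ≤ q) := ⟨hq⟩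
  refine ⟨convex_Ici 0, fun s hs t ht a b ha hb hab => ?_⟩
  refine le_of_forall_pos_le_add fun ε hε => ?_
  obtain ⟨v, hv, hvlt⟩ := exists_mem_l2norm_sub_lt ⟨0, zero_mem_lqBall hq hs⟩ h
    (lt_add_of_pos_right _ hε)
  obtain ⟨w, hw, hwlt⟩ := exists_mem_l2norm_sub_lt ⟨0, zero_mem_lqBall hq ht⟩ h
    (lt_add_of_pos_right _ hε)
  have hmem : a • v + b • w ∈ {x | lqNorm q x ≤ a • s + b • t} := by
    simp only [Set.mem_ofPred_eq, lqNorm_eq_norm_toLp hq, smul_eq_mul] at hv hw ⊢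
    rw [WithLp.toLp_add, WithLp.toLp_smul, WithLp.toLp_smul]
    refine (norm_add_le _ _).trans ?_
    rw [norm_smul, norm_smul, Real.norm_of_nonneg ha, Real.norm_of_nonneg hb]
    gcongr
  have hsub : h - (a • v + b • w) = a • (h - v) + b • (h - w) := by
    rw [smul_sub, smul_sub, sub_add_sub_comm, ← add_smul, hab, one_smul]
  have hle : l2norm (h - (a • v + b • w)) ≤ a * l2norm (h - v) + b * l2norm (h - w) := by
    rw [hsub]
    simp only [l2norm_eq_norm_toLp, WithLp.toLp_add, WithLp.toLp_smul]
    refine (norm_add_le _ _).trans ?_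
    rw [norm_smul, norm_smul, Real.norm_of_nonneg ha, Real.norm_of_nonneg hb]
  simp only [smul_eq_mul] at hmem ⊢
  calc _ ≤ _ := distL2_le_of_mem hmem h
    _ ≤ _ := hle
    _ ≤ a * (distL2 {x | lqNorm q x ≤ s} h + ε) + b * (distL2 {x | lqNorm q x ≤ t} h + ε) := by
      gcongr
    _ = _ := by linear_combination ε * hab

instance isProbabilityMeasure_stdGaussian (n : ℕ) :
    IsProbabilityMeasure (_root_.stdGaussian n) := by
  unfold _root_.stdGaussian
  infer_instance

instance isOpenPosMeasure_stdGaussian (n : ℕ) :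
    (_root_.stdGaussian n).IsOpenPosMeasure := by
  have : (gaussianReal 0 1).IsOpenPosMeasure :=
    (gaussianReal_absolutelyContinuous' 0 one_ne_zero).isOpenPosMeasure
  unfold _root_.stdGaussian
  infer_instance

lemma integrable_l2norm (n : ℕ) : Integrable l2norm (_root_.stdGaussian n) := by
  have hsum : Integrable (fun h : Fin n → ℝ => ∑ i, |h i|) (_root_.stdGaussian n) := by
    refine integrable_finsetSum _ fun i _ => ?_
    have hid : Integrable (fun x : ℝ => |x|) (gaussianReal 0 1) :=
      ((memLp_id_gaussianReal 1).integrable (by simp)).abs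
    exact integrable_comp_eval (μ := fun _ : Fin n => gaussianReal 0 1) (i := i) hid
  have hcont : Continuous (l2norm (n := n)) := by
    unfold l2norm
    fun_prop
  refine hsum.mono' hcont.aestronglyMeasurable (Eventually.of_forall fun h => ?_)
  rw [l2norm, Real.norm_of_nonneg (Real.sqrt_nonneg _)]
  refine Real.sqrt_le_iff.2 ⟨Finset.sum_nonneg fun i _ => abs_nonneg _, ?_⟩
  simpa using Finset.sum_sq_le_sq_sum_of_nonneg (s := Finset.univ) (f := fun i => |h i|)
    fun i _ => abs_nonneg _

lemma distL2_lqBall_le_l2norm {n : ℕ} {q : ℝ≥0∞} (hq : 1 ≤ q) {t : ℝ} (ht : 0 ≤ t)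
    (h : Fin n → ℝ) : distL2 {x | lqNorm q x ≤ t} h ≤ l2norm h := by
  simpa using distL2_le_of_mem (zero_mem_lqBall hq ht) h

lemma integrable_distL2_lqBall {n : ℕ} {q : ℝ≥0∞} (hq : 1 ≤ q) {t : ℝ} (ht : 0 ≤ t) :
    Integrable (distL2 {x | lqNorm q x ≤ t}) (_root_.stdGaussian n) := by
  refine (integrable_l2norm n).mono' (continuous_distL2 _).aestronglyMeasurable
    (Eventually.of_forall fun h => ?_)
  rw [Real.norm_of_nonneg (distL2_nonneg _ _)]
  exact distL2_lqBall_le_l2norm hq ht h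

lemma convexOn_integral_distL2_lqBall (n : ℕ) {q : ℝ≥0∞} (hq : 1 ≤ q) :
    ConvexOn ℝ (Set.Ici 0)
      fun t => ∫ h, distL2 {x | lqNorm q x ≤ t} h ∂_root_.stdGaussian n := by
  refine ⟨convex_Ici 0, fun s hs t ht a b ha hb hab => ?_⟩
  simp only [smul_eq_mul]
  have hst : 0 ≤ a * s + b * t := add_nonneg (mul_nonneg ha hs) (mul_nonneg hb ht)
  have hs' := (integrable_distL2_lqBall (n := n) hq hs).const_mul a
  have ht' := (integrable_distL2_lqBall (n := n) hq ht).const_mul b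
  rw [← integral_const_mul, ← integral_const_mul, ← integral_add hs' ht']
  exact integral_mono (integrable_distL2_lqBall hq hst) (hs'.add ht') fun h =>
    (convexOn_distL2_lqBall hq h).2 hs ht ha hb hab

lemma tendsto_integral_distL2_lqBall (n : ℕ) {q : ℝ≥0∞} (hq : 1 ≤ q) :
    Tendsto (fun t => ∫ h, distL2 {x | lqNorm q x ≤ t} h ∂_root_.stdGaussian n)
      atTop (nhds 0) := by
  rw [← integral_zero (Fin n → ℝ) ℝ (μ := _root_.stdGaussian n)]
  refine tendsto_integral_filter_of_dominated_convergence l2norm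
    (Eventually.of_forall fun t => (continuous_distL2 _).aestronglyMeasurable) ?_
    (integrable_l2norm n) (Eventually.of_forall fun h => ?_)
  · filter_upwards [eventually_ge_atTop 0] with t ht
    refine Eventually.of_forall fun h => ?_
    rw [Real.norm_of_nonneg (distL2_nonneg _ _)]
    exact distL2_lqBall_le_l2norm hq ht h
  · refine tendsto_const_nhds.congr' ?_
    filter_upwards [eventually_ge_atTop (lqNorm q h)] with t ht
    refine (distL2_nonneg _ _).antisymm ?_
    simpa [l2norm] using distL2_le_of_mem (C := {x | lqNorm q x ≤ t}) ht h

lemma integral_distL2_lqBall_pos {n : ℕ} (hn : 1 ≤ n) {q : ℝ≥0∞} (hq : 1 ≤ q) {t : ℝ}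
    (ht : 0 ≤ t) : 0 < ∫ h, distL2 {x | lqNorm q x ≤ t} h ∂_root_.stdGaussian n := by
  have : Fact (1 ≤ q) := ⟨hq⟩
  let i : Fin n := ⟨0, hn⟩
  refine integral_pos_of_integrable_nonneg_nonzero
    (x := fun _ => t + 1) (continuous_distL2 _) (integrable_distL2_lqBall hq ht) (distL2_nonneg _) ?_
  intro hzero
  obtain ⟨w, hw, hlt⟩ := exists_mem_l2norm_sub_lt ⟨0, zero_mem_lqBall hq ht⟩ _
    (hzero.trans_lt one_pos)
  rw [Set.mem_ofPred_eq, lqNorm_eq_norm_toLp hq] at hw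
  rw [l2norm_eq_norm_toLp] at hlt
  have hwi := (PiLp.norm_apply_le (WithLp.toLp q w) i).trans hw
  have hhi := (PiLp.norm_apply_le (WithLp.toLp 2 ((fun _ => t + 1) - w)) i).trans_lt hlt
  simp only [Real.norm_eq_abs, Pi.sub_apply, abs_le, abs_lt] at hwi hhi
  linarith

lemma ConvexOn.strictAntiOn_Ici_of_tendsto {f : ℝ → ℝ} {a c : ℝ}
    (hf : ConvexOn ℝ (Set.Ici a) f) (hlt : ∀ t ∈ Set.Ici a, c < f t)
    (hlim : Tendsto f atTop (nhds c)) : StrictAntiOn f (Set.Ici a) := by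
  intro s hs t ht hst
  by_contra! hle
  obtain ⟨u, hu, htu⟩ := ((hlim.eventually_lt_const (hlt t ht)).and
    (eventually_gt_atTop t)).exists
  refine hu.not_ge ?_
  exact hf.le_right_of_left_le hs (ht.trans htu.le : a ≤ u)
    (by rw [openSegment_eq_Ioo (hst.trans htu)]; exact ⟨hst, htu⟩) hle

/-- For `n ≥ 1` and `1 ≤ p ≤ ∞` with conjugate exponent `q = p*`, the
function `D_p` is strictly decreasing and convex on `[0, ∞)`, and tends to `0` at `∞`. -/
theorem Dp_strictAnti_convex_tendsto_zero (n : ℕ) (hn : 1 ≤ n)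
    (p q : ℝ≥0∞) (hp : 1 ≤ p) (hpq : 1 / p + 1 / q = 1) :
    StrictAntiOn (Dp q n) (Set.Ici 0) ∧
    ConvexOn ℝ (Set.Ici 0) (Dp q n) ∧
    Tendsto (Dp q n) atTop (nhds 0) := by
  have hq : 1 ≤ q := by
    have hle : 1 / q ≤ 1 := le_add_self.trans_eq hpq
    simpa using hle
  have hpos (t : ℝ) (ht : t ∈ Set.Ici (0 : ℝ)) := integral_distL2_lqBall_pos hn hq ht
  have hconv := convexOn_integral_distL2_lqBall n hq
  have hlim := tendsto_integral_distL2_lqBall n hq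
  have hn' : (0 : ℝ) < 1 / n := by positivity
  refine ⟨fun s hs t ht hst => ?_, ?_, ?_⟩
  · have hlt := hconv.strictAntiOn_Ici_of_tendsto hpos hlim hs ht hst
    have ht0 := hpos t ht
    unfold Dp
    gcongr
  · exact (hconv.pow (fun _ ht => (hpos _ ht).le) 2).smul hn'.le
  · have hmul := (hlim.pow 2).const_mul (1 / (n : ℝ))
    rwa [zero_pow two_ne_zero, mul_zero] at hmul
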